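/- For each M ∈ ℕ there exists σ > 0 such that the following holds provided α > 0 is sufficiently small. Let X₀ : [0,1) → B_α be an admissible curve and for n = 0,1,… set Θ_n = {θ ∈ ℝ/ℤ : |f_n(θ, X₀(θ))| < σ}. Then the Lebesgue measure of ⋃_{n=1}^{N(α)+M} Θ_n is at most 2/3. -/

import Mathlib

open Set MeasureTheory Filter
open scoped ENNReal

noncomputable section

/-- The quadratic map `f(x) = a - x²`. -/
def qm (a : ℝ) : ℝ → ℝ := fun x => a - x ^ 2

/-- The critical point `0` of `qm a` is strictly pre-periodic: its forward orbit never
returns to `0` and is eventually periodic. -/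
def StrictlyPreperiodic (a : ℝ) : Prop :=
  (∀ i : ℕ, 1 ≤ i → (qm a)^[i] 0 ≠ 0) ∧
    ∃ m p : ℕ, 1 ≤ m ∧ 1 ≤ p ∧ (qm a)^[m + p] 0 = (qm a)^[m] 0

/-- A lift of the Viana skew product `F(θ, x) = (dθ, f(x) + αφ(θ))` to `ℝ × ℝ`;
for `φ` of period `1` this is a lift of the corresponding map of `(ℝ/ℤ) × ℝ`. -/
def Viana (a : ℝ) (d : ℕ) (φ : ℝ → ℝ) (α : ℝ) : ℝ × ℝ → ℝ × ℝ :=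
  fun p => ((d : ℝ) * p.1, qm a p.2 + α * φ p.1)

/-- The fibre maps `f_n`, defined by `F^n(θ, x) = (d^n θ, f_n(θ, x))`. -/
def fn (a : ℝ) (d : ℕ) (φ : ℝ → ℝ) (α : ℝ) (n : ℕ) (θ x : ℝ) : ℝ :=
  ((Viana a d φ α)^[n] (θ, x)).2

/-- Endpoints of the shadowing intervals: `IEnd a α n` gives the endpoints of `I_{n+1}`, where
`I₁ = [c₁ - 2α, c₁ + 2α]` and `I_{n+1}` is the closed interval containing `f(I_n)` both of whose
complementary components in `I_{n+1}` have length `α`. -/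
def IEnd (a α : ℝ) : ℕ → ℝ × ℝ
  | 0 => (qm a 0 - 2 * α, qm a 0 + 2 * α)
  | n + 1 =>
      (sInf (qm a '' Set.Icc (IEnd a α n).1 (IEnd a α n).2) - α,
        sSup (qm a '' Set.Icc (IEnd a α n).1 (IEnd a α n).2) + α)

/-- The shadowing interval `I_n`, for `n ≥ 1`. -/
def Iseq (a α : ℝ) (n : ℕ) : Set ℝ := Set.Icc (IEnd a α (n - 1)).1 (IEnd a α (n - 1)).2

/-- The length `|I_{n+1}|` of the shadowing interval `I_{n+1}`. -/
def len (a α : ℝ) (n : ℕ) : ℝ := (IEnd a α n).2 - (IEnd a α n).1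

/-- `N(α)`: the maximal integer `N` such that `|I_n| < ξ₀` for all `1 ≤ n ≤ N` and
`∑_{n=1}^{N} |I_n| ≤ ξ₀`. -/
def Nal (a ξ₀ α : ℝ) : ℕ :=
  sSup {N : ℕ | (∀ n : ℕ, 1 ≤ n → n ≤ N → len a α (n - 1) < ξ₀) ∧
    ∑ n ∈ Finset.range N, len a α n ≤ ξ₀}

/-- A curve `X : [0,1) → B = [-β, β]` is admissible if it is the image of a horizontal curve
under `F^n` for some `n ≥ n₀ + 1`: there are `ω = [j/dⁿ, (j+1)/dⁿ) ∈ 𝒫_n` and `x₀ ∈ B` with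
`X(dⁿθ mod 1) = f_n(θ, x₀)` for all `θ ∈ ω`; equivalently `X(t) = f_n((t+j)/dⁿ, x₀)` on `[0,1)`. -/
def Admissible (a : ℝ) (d : ℕ) (φ : ℝ → ℝ) (α β : ℝ) (n₀ : ℕ) (X : ℝ → ℝ) : Prop :=
  ∃ n : ℕ, n₀ + 1 ≤ n ∧ ∃ j : ℕ, j < d ^ n ∧ ∃ x₀ ∈ Set.Icc (-β) β,
    ∀ θ ∈ Set.Ico (0 : ℝ) 1, X θ = fn a d φ α n ((θ + j) / (d : ℝ) ^ n) x₀

theorem exists_growth_bounds {D : ℕ → ℝ} (hD : ∀ n, D n ≠ 0) {k p : ℕ} (hp : 1 ≤ p) {μ : ℝ}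
    (h : ∀ n, k ≤ n → D (n + p) = μ * D n) :
    ∃ r c C : ℝ, 0 < r ∧ 0 < c ∧ 0 < C ∧ r ^ p = |μ| ∧
      ∀ n, c * r ^ n ≤ |D n| ∧ |D n| ≤ C * r ^ n := by
  have hμ : 0 < |μ| := by
    rw [abs_pos]
    rintro rfl
    exact hD _ ((h k le_rfl).trans (zero_mul _))
  set r : ℝ := |μ| ^ ((p : ℝ)⁻¹) with hr
  have hr0 : 0 < r := Real.rpow_pos_of_pos hμ _
  have hrp : r ^ p = |μ| := Real.rpow_inv_natCast_pow hμ.le (by omega)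
  set ρ : ℕ → ℝ := fun n => |D n| / r ^ n with hρ
  have hρ0 : ∀ n, 0 < ρ n := fun n => div_pos (abs_pos.2 (hD n)) (pow_pos hr0 n)
  have hper : ∀ n, k ≤ n → ρ (n + p) = ρ n := by
    intro n hn
    simp only [hρ, h n hn, abs_mul, pow_add, hrp]
    field_simp
  have hfin : ∀ n, ∃ j ∈ Finset.range (k + p), ρ n = ρ j := by
    intro n
    induction n using Nat.strong_induction_on with
    | _ n ih =>
      rcases lt_or_ge n (k + p) with hn | hn
      · exact ⟨n, Finset.mem_range.2 hn, rfl⟩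
      · obtain ⟨j, hj, hj'⟩ := ih (n - p) (by omega)
        refine ⟨j, hj, ?_⟩
        rw [← hj', ← hper (n - p) (by omega)]
        congr 1
        omega
  have hne : (Finset.range (k + p)).Nonempty := Finset.nonempty_range_iff.2 (by omega)
  obtain ⟨i, -, hi⟩ := Finset.exists_min_image (Finset.range (k + p)) ρ hne
  obtain ⟨l, -, hl⟩ := Finset.exists_max_image (Finset.range (k + p)) ρ hne
  refine ⟨r, ρ i, ρ l, hr0, hρ0 i, hρ0 l, hrp, fun n => ?_⟩
  obtain ⟨j, hj, hn⟩ := hfin n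
  have hDn : |D n| = ρ j * r ^ n := by
    rw [← hn]
    simp only [hρ]
    field_simp
  rw [hDn]
  exact ⟨mul_le_mul_of_nonneg_right (hi j hj) (pow_pos hr0 n).le,
    mul_le_mul_of_nonneg_right (hl j hj) (pow_pos hr0 n).le⟩

/-- The polynomials `-fⁿ(0)` in the parameter `a`. -/
def critPoly : ℕ → Polynomial ℤ
  | 0 => 0
  | n + 1 => critPoly n ^ 2 - Polynomial.X

theorem aeval_critPoly (a : ℝ) (n : ℕ) :
    Polynomial.aeval a (critPoly n) = -(qm a)^[n] 0 := by
  induction n with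
  | zero => simp [critPoly]
  | succ n ih =>
    rw [Function.iterate_succ_apply']
    simp [critPoly, ih, qm]

theorem natDegree_critPoly_le (n : ℕ) : (critPoly (n + 1)).natDegree ≤ 2 ^ n := by
  induction n with
  | zero => simp [critPoly]
  | succ n ih =>
    rw [critPoly]
    refine (Polynomial.natDegree_sub_le _ _).trans (max_le ?_ ?_)
    · refine Polynomial.natDegree_pow_le.trans ?_
      rw [pow_succ]
      omega
    · rw [Polynomial.natDegree_X]
      exact Nat.one_le_two_pow

theorem isMonicOfDegree_critPoly (n : ℕ) :
    Polynomial.IsMonicOfDegree (critPoly (n + 2)) (2 ^ (n + 1)) := by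
  have key : ∀ p : Polynomial ℤ, ∀ k, 1 ≤ k → Polynomial.IsMonicOfDegree (p ^ 2) (2 * k) →
      Polynomial.IsMonicOfDegree (p ^ 2 - Polynomial.X) (2 * k) := by
    intro p k hk hp
    refine hp.sub ?_
    rw [Polynomial.natDegree_X]
    omega
  induction n with
  | zero =>
    refine key _ 1 le_rfl ?_
    have : (critPoly (0 + 1)) ^ 2 = Polynomial.X ^ 2 := by simp [critPoly]
    rw [this]
    exact Polynomial.isMonicOfDegree_X_pow ℤ 2
  | succ n ih =>
    have h2 : Polynomial.IsMonicOfDegree (critPoly (n + 2) ^ 2) (2 ^ (n + 1) * 2) := ih.pow 2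
    rw [mul_comm] at h2
    have := key _ _ Nat.one_le_two_pow h2
    rw [pow_succ, mul_comm]
    exact this

theorem isIntegral_of_iterate_eq {a : ℝ} {m p : ℕ} (hm : 1 ≤ m) (hp : 1 ≤ p)
    (h : (qm a)^[m + p] 0 = (qm a)^[m] 0) : IsIntegral ℤ a := by
  obtain ⟨m, rfl⟩ := Nat.exists_eq_add_of_le' hm
  obtain ⟨p, rfl⟩ := Nat.exists_eq_add_of_le' hp
  have e : m + 1 + (p + 1) = m + p + 2 := by ring
  rw [e] at h
  have hmon : Polynomial.IsMonicOfDegree (critPoly (m + p + 2) - critPoly (m + 1))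
      (2 ^ (m + p + 1)) := by
    refine (isMonicOfDegree_critPoly (m + p)).sub
      ((natDegree_critPoly_le m).trans_lt (Nat.pow_lt_pow_right (by norm_num) (by omega)))
  refine ⟨_, hmon.monic, ?_⟩
  have : Polynomial.aeval a (critPoly (m + p + 2) - critPoly (m + 1)) = 0 := by
    rw [map_sub, aeval_critPoly, aeval_critPoly, h, sub_self]
  exact this

theorem isIntegral_iterate {a : ℝ} (ha : IsIntegral ℤ a) (n : ℕ) :
    IsIntegral ℤ ((qm a)^[n] 0) := by
  induction n with
  | zero => exact isIntegral_zero
  | succ n ih =>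
    rw [Function.iterate_succ_apply']
    exact ha.sub (ih.pow 2)

theorem two_mul_ne_one_of_isIntegral {w : ℝ} (hw : IsIntegral ℤ w) : 2 * w ≠ 1 := by
  intro h
  have hw' : w = algebraMap ℚ ℝ (1 / 2) := by
    simp
    linarith
  rw [hw', isIntegral_algebraMap_iff (algebraMap ℚ ℝ).injective,
    IsIntegrallyClosed.isIntegral_iff] at hw
  obtain ⟨y, hy⟩ := hw
  have h2 : ((2 * y : ℤ) : ℚ) = 1 := by
    push_cast
    simp at hy
    rw [hy]
    norm_num
  have : 2 * y = 1 := by exact_mod_cast h2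
  omega

/-- The derivative `Dfⁿ(f(0))` along the critical orbit. -/
def critDeriv (a : ℝ) (n : ℕ) : ℝ := ∏ i ∈ Finset.range n, (-2 * (qm a)^[i + 1] 0)

/-- The derivative along the critical orbit has an exact exponential growth rate, which is not
neutral because `2` is not a unit among the algebraic integers. -/
theorem exists_critDeriv_bounds {a : ℝ} (h : StrictlyPreperiodic a) :
    ∃ r c C : ℝ, 0 < r ∧ r ≠ 1 ∧ 0 < c ∧ 0 < C ∧
      ∀ n, c * r ^ n ≤ |critDeriv a n| ∧ |critDeriv a n| ≤ C * r ^ n := by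
  obtain ⟨hne, m, p, hm, hp, hmp⟩ := h
  obtain ⟨k, rfl⟩ := Nat.exists_eq_add_of_le' hm
  have hper : ∀ n, k + 1 ≤ n → (qm a)^[n + p] 0 = (qm a)^[n] 0 := by
    intro n hn
    obtain ⟨j, rfl⟩ := Nat.exists_eq_add_of_le' hn
    rw [add_assoc, Function.iterate_add_apply, hmp, ← Function.iterate_add_apply]
  have hD : ∀ n, critDeriv a n ≠ 0 := fun n =>
    Finset.prod_ne_zero_iff.2 fun i _ => mul_ne_zero (by norm_num) (hne _ (by omega))
  set μ : ℝ := ∏ i ∈ Finset.range p, (-2 * (qm a)^[k + i + 1] 0) with hμ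
  have hDp : ∀ n, k ≤ n → critDeriv a (n + p) = μ * critDeriv a n := by
    intro n hn
    induction n, hn using Nat.le_induction with
    | base => rw [critDeriv, Finset.prod_range_add, mul_comm]; rfl
    | succ n hn ih =>
      have e : n + 1 + p = n + p + 1 := by ring
      have e' : (qm a)^[n + p + 1] 0 = (qm a)^[n + 1] 0 := by
        rw [← e]; exact hper _ (by omega)
      have h1 : critDeriv a (n + p + 1) = critDeriv a (n + p) * (-2 * (qm a)^[n + p + 1] 0) :=
        Finset.prod_range_succ _ _
      have h2 : critDeriv a (n + 1) = critDeriv a n * (-2 * (qm a)^[n + 1] 0) :=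
        Finset.prod_range_succ _ _
      rw [e, h1, h2, ih, e', mul_assoc]
  obtain ⟨r, c, C, hr, hc, hC, hrp, hb⟩ := exists_growth_bounds hD hp hDp
  refine ⟨r, c, C, hr, ?_, hc, hC, hb⟩
  rintro rfl
  have hμ2 : μ ^ 2 = 1 := by rw [← sq_abs, ← hrp]; simp
  have haint := isIntegral_of_iterate_eq hm hp hmp
  have hz : IsIntegral ℤ (∏ i ∈ Finset.range p, (qm a)^[k + i + 1] 0) :=
    IsIntegral.prod _ fun i _ => isIntegral_iterate haint _
  have h2 : IsIntegral ℤ (2 : ℝ) := by exact_mod_cast isIntegral_algebraMap (R := ℤ) (x := (2 : ℤ))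
  have hw := (h2.pow (2 * p - 1)).mul (hz.pow 2)
  refine two_mul_ne_one_of_isIntegral hw ?_
  rw [← hμ2, hμ, Finset.prod_mul_distrib, Finset.prod_const, Finset.card_range, ← mul_assoc,
    ← pow_succ', mul_pow, ← pow_mul, show 2 * p - 1 + 1 = p * 2 by omega]
  congr 1
  rw [Even.neg_pow ⟨p, by ring⟩]

theorem AnalyticOnNhd.eq_const_of_infinite {g : ℝ → ℝ} (hg : AnalyticOnNhd ℝ g univ) {s : Set ℝ}
    (hs : s.Infinite) (hsI : s ⊆ Icc 0 1) {c : ℝ} (h : ∀ x ∈ s, g x = c) : ∀ x, g x = c := by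
  obtain ⟨z, -, hz⟩ := hs.exists_accPt_of_subset_isCompact isCompact_Icc hsI
  have hfr : ∃ᶠ x in nhdsWithin z {z}ᶜ, g x = c :=
    (accPt_iff_frequently_nhdsNE.1 hz).mono h
  have := hg.eqOn_of_preconnected_of_frequently_eq (g := fun _ => c) analyticOnNhd_const
    isPreconnected_univ (mem_univ z) hfr
  exact fun x => this (mem_univ x)

/-- Two sets of measure more than `1/2`, one a translate of the other modulo `1`, meet. -/
theorem volume_inter_shift_pos {Z : Set ℝ} (hZ : MeasurableSet Z)
    (hper : ∀ x, x + 1 ∈ Z ↔ x ∈ Z) (hvol : (2 / 3 : ℝ≥0∞) ≤ volume (Z ∩ Ico 0 1)) (τ : ℝ) :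
    volume ({x | x ∈ Z ∧ x + τ ∈ Z} ∩ Ico 0 1) ≠ 0 := by
  have hS : volume ({x | x + τ ∈ Z} ∩ Ico (0 : ℝ) 1) = volume (Z ∩ Ico 0 1) := by
    have h1 : volume ({x | x + τ ∈ Z} ∩ Ico (0 : ℝ) 1) = volume (Z ∩ Ico τ (τ + 1)) := by
      rw [← measure_preimage_add_right volume τ (Z ∩ Ico τ (τ + 1))]
      congr 1
      ext x
      simp only [mem_inter_iff, mem_ofPred_eq, mem_Ico, mem_preimage]
      constructor
      · rintro ⟨h, h0, h1⟩
        exact ⟨h, by linarith, by linarith⟩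
      · rintro ⟨h, h0, h1⟩
        exact ⟨h, by linarith, by linarith⟩
    rw [h1]
    have hinv : ∀ (g : AddSubgroup.zmultiples (1 : ℝ)), (fun x => g +ᵥ x) ⁻¹' Z = Z := by
      rintro ⟨g, hg⟩
      obtain ⟨n, rfl⟩ := AddSubgroup.mem_zmultiples_iff.1 hg
      have hp : Function.Periodic (fun x => x ∈ Z) 1 := fun x => propext (hper x)
      ext x
      have := (hp.zsmul n) x
      simp only [mem_preimage, AddSubgroup.vadd_def, vadd_eq_add]
      rw [add_comm]
      exact iff_of_eq this
    have hI := (isAddFundamentalDomain_Ioc (one_pos : (0 : ℝ) < 1) τ volume).measure_set_eq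
      (isAddFundamentalDomain_Ioc (one_pos : (0 : ℝ) < 1) 0 volume) hZ hinv
    have e : ∀ t : ℝ, volume (Z ∩ Ico t (t + 1)) = volume (Z ∩ Ioc t (t + 1)) := fun t =>
      measure_congr ((ae_eq_refl Z).inter Ico_ae_eq_Ioc)
    have e0 := e 0
    rw [zero_add] at e0
    rw [e, e0, hI, zero_add]
  intro h0
  have hmeas : MeasurableSet ({x | x + τ ∈ Z} ∩ Ico (0 : ℝ) 1) :=
    (hZ.preimage (measurable_add_const τ)).inter measurableSet_Ico
  have hU := measure_union_add_inter (μ := volume) (Z ∩ Ico (0 : ℝ) 1) hmeas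
  have hle : volume ((Z ∩ Ico (0 : ℝ) 1) ∪ ({x | x + τ ∈ Z} ∩ Ico (0 : ℝ) 1)) ≤ 1 := by
    refine (measure_mono (union_subset inter_subset_right inter_subset_right)).trans ?_
    simp
  have hint : volume ((Z ∩ Ico (0 : ℝ) 1) ∩ ({x | x + τ ∈ Z} ∩ Ico (0 : ℝ) 1)) = 0 :=
    measure_mono_null (t := {x | x ∈ Z ∧ x + τ ∈ Z} ∩ Ico 0 1)
      (fun x hx => ⟨⟨hx.1.1, hx.2.1⟩, hx.1.2⟩) h0
  rw [hint, hS, add_zero] at hU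
  have : (2 / 3 : ℝ≥0∞) + 2 / 3 ≤ 1 := by
    calc (2 / 3 : ℝ≥0∞) + 2 / 3 ≤ _ := add_le_add hvol hvol
      _ ≤ 1 := hU ▸ hle
  have h' := ENNReal.toReal_mono (by simp) this
  rw [ENNReal.toReal_add (by finiteness) (by finiteness)] at h'
  norm_num at h'

theorem Function.Periodic.const_of_inv_pow {φ : ℝ → ℝ} (hc : Continuous φ) {d : ℕ} (hd : 2 ≤ d)
    (h : ∀ n : ℕ, Function.Periodic φ (1 / (d : ℝ) ^ n)) (x : ℝ) : φ x = φ 0 := by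
  have hd1 : (1 : ℝ) < d := by exact_mod_cast hd
  have h0 : Tendsto (fun n : ℕ => 1 / (d : ℝ) ^ n) atTop (nhds 0) := by
    simpa [Function.comp_def] using tendsto_inv_atTop_zero.comp (tendsto_pow_atTop_atTop_of_one_lt hd1)
  have hp : ∀ n : ℕ, 0 < 1 / (d : ℝ) ^ n := fun n => by positivity
  have hlim : Tendsto (fun n : ℕ => x - ⌊x / (1 / (d : ℝ) ^ n)⌋ * (1 / (d : ℝ) ^ n)) atTop
      (nhds 0) := by
    refine squeeze_zero (fun n => ?_) (fun n => ?_) h0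
    · have := Int.floor_le (x / (1 / (d : ℝ) ^ n))
      rw [le_div_iff₀ (hp n)] at this
      linarith
    · have := Int.lt_floor_add_one (x / (1 / (d : ℝ) ^ n))
      rw [div_lt_iff₀ (hp n)] at this
      linarith
  have h1 := (hc.tendsto 0).comp hlim
  have h2 : (φ ∘ fun n : ℕ => x - ⌊x / (1 / (d : ℝ) ^ n)⌋ * (1 / (d : ℝ) ^ n)) = fun _ => φ x := by
    funext n
    exact (h n).sub_int_mul_eq _
  rw [h2] at h1
  exact tendsto_nhds_unique tendsto_const_nhds h1

section WeightedSum

variable {φ : ℝ → ℝ} {d : ℕ} {w : ℕ → ℝ}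

theorem summable_weightedSum (hφb : ∀ θ, |φ θ| ≤ 1) (hw : Summable fun j => |w j|) (θ : ℝ) :
    Summable fun j => w j * φ ((d : ℝ) ^ j * θ) := by
  refine Summable.of_norm_bounded hw fun j => ?_
  rw [Real.norm_eq_abs, abs_mul]
  exact mul_le_of_le_one_right (abs_nonneg _) (hφb _)

theorem continuous_weightedSum (hφc : Continuous φ) (hφb : ∀ θ, |φ θ| ≤ 1)
    (hw : Summable fun j => |w j|) :
    Continuous fun θ : ℝ => ∑' j, w j * φ ((d : ℝ) ^ j * θ) := by
  refine continuous_tsum (fun j => by fun_prop) hw fun j θ => ?_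
  rw [Real.norm_eq_abs, abs_mul]
  exact mul_le_of_le_one_right (abs_nonneg _) (hφb _)

theorem weightedSum_add_sub (hφb : ∀ θ, |φ θ| ≤ 1) (hd : 2 ≤ d)
    (hw : Summable fun j => |w j|) {n : ℕ} (hn : Function.Periodic φ (1 / (d : ℝ) ^ n)) (θ : ℝ) :
    ∑' j, w j * φ ((d : ℝ) ^ j * (θ + 1 / (d : ℝ) ^ (n + 1))) -
      ∑' j, w j * φ ((d : ℝ) ^ j * θ) = w 0 * (φ (θ + 1 / (d : ℝ) ^ (n + 1)) - φ θ) := by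
  have hd0 : (d : ℝ) ≠ 0 := by
    have : d ≠ 0 := by omega
    exact_mod_cast this
  rw [← (summable_weightedSum hφb hw _).tsum_sub (summable_weightedSum hφb hw _),
    tsum_eq_single 0]
  · simp
    ring
  · intro j hj
    obtain ⟨i, rfl⟩ := Nat.exists_eq_succ_of_ne_zero hj
    have : φ ((d : ℝ) ^ (i + 1) * (θ + 1 / (d : ℝ) ^ (n + 1))) = φ ((d : ℝ) ^ (i + 1) * θ) := by
      have e : (d : ℝ) ^ (i + 1) * (θ + 1 / (d : ℝ) ^ (n + 1)) =
          (d : ℝ) ^ (i + 1) * θ + ((d ^ i : ℕ) : ℝ) * (1 / (d : ℝ) ^ n) := by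
        push_cast
        field_simp
        ring
      rw [e]
      exact hn.nat_mul _ _
    rw [Nat.succ_eq_add_one, this, sub_self]

theorem weightedSum_periodic (hφp : Function.Periodic φ 1) :
    Function.Periodic (fun θ : ℝ => ∑' j, w j * φ ((d : ℝ) ^ j * θ)) 1 := by
  intro θ
  refine tsum_congr fun j => ?_
  have e : (d : ℝ) ^ j * (θ + 1) = (d : ℝ) ^ j * θ + ((d ^ j : ℕ) : ℝ) * 1 := by
    push_cast
    ring
  rw [e, hφp.nat_mul]

/-- A lacunary sum of a non-constant analytic function cannot take finitely many values on a set
of measure at least `2/3`. -/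
theorem volume_weightedSum_mem_lt (hφa : ∀ x, AnalyticAt ℝ φ x) (hφp : Function.Periodic φ 1)
    (hφnc : ∃ s t : ℝ, φ s ≠ φ t) (hφb : ∀ θ, |φ θ| ≤ 1) (hd : 2 ≤ d)
    (hw : Summable fun j => |w j|) (hw0 : w 0 ≠ 0) {F : Set ℝ} (hF : F.Finite) :
    volume ({θ : ℝ | ∑' j, w j * φ ((d : ℝ) ^ j * θ) ∈ F} ∩ Ico 0 1) < 2 / 3 := by
  by_contra! hvol
  have hφc : Continuous φ := continuous_iff_continuousAt.2 fun x => (hφa x).continuousAt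
  set T : ℝ → ℝ := fun θ : ℝ => ∑' j, w j * φ ((d : ℝ) ^ j * θ) with hT
  have hTc : Continuous T := continuous_weightedSum hφc hφb hw
  have hTp : Function.Periodic T 1 := weightedSum_periodic hφp
  have hZ : MeasurableSet {θ | T θ ∈ F} := hTc.measurable hF.measurableSet
  have hZp : ∀ x, x + 1 ∈ {θ | T θ ∈ F} ↔ x ∈ {θ | T θ ∈ F} := fun x => by
    simp only [mem_ofPred_eq, hTp x]
  have hall : ∀ n : ℕ, Function.Periodic φ (1 / (d : ℝ) ^ n) := by
    intro n
    induction n with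
    | zero => simpa using hφp
    | succ n ih =>
      set τ : ℝ := 1 / (d : ℝ) ^ (n + 1) with hτ
      set W : Set ℝ := {x | x ∈ {θ | T θ ∈ F} ∧ x + τ ∈ {θ | T θ ∈ F}} ∩ Ico 0 1 with hW
      have hWinf : W.Infinite := fun hfin =>
        volume_inter_shift_pos hZ hZp hvol τ (hfin.measure_zero volume)
      have hmaps : MapsTo (fun θ => T (θ + τ) - T θ) W (image2 (· - ·) F F) := by
        rintro θ ⟨⟨h1, h2⟩, -⟩
        exact mem_image2_of_mem h2 h1
      obtain ⟨c, -, hc⟩ : ∃ c ∈ image2 (· - ·) F F,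
          (W ∩ (fun θ => T (θ + τ) - T θ) ⁻¹' {c}).Infinite := by
        by_contra! hcon
        refine hWinf (Set.Finite.subset ((hF.image2 _ hF).biUnion
          fun c hc => Set.not_infinite.1 (not_infinite.2 (hcon c hc))) fun θ hθ => ?_)
        exact mem_biUnion (hmaps hθ) ⟨hθ, rfl⟩
      have hg : AnalyticOnNhd ℝ (fun θ => w 0 * (φ (θ + τ) - φ θ)) univ := by
        intro x _
        have hadd : AnalyticAt ℝ (fun θ => θ + τ) x := analyticAt_id.fun_add analyticAt_const
        exact analyticAt_const.mul
          ((AnalyticAt.comp (g := φ) (f := fun θ => θ + τ) (hφa _) hadd).fun_sub (hφa x))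
      have hconst := hg.eq_const_of_infinite hc (fun θ hθ => Ico_subset_Icc_self hθ.1.2)
        (c := c) fun θ hθ => by
          rw [← weightedSum_add_sub hφb hd hw ih θ]
          exact hθ.2
      have hstep : ∀ θ, φ (θ + τ) = φ θ + c / w 0 := by
        intro θ
        have := hconst θ
        field_simp
        linarith
      have hmul : ∀ (k : ℕ) θ, φ (θ + k * τ) = φ θ + k * (c / w 0) := by
        intro k θ
        induction k with
        | zero => simp
        | succ k ihk =>
          have e : θ + ((k + 1 : ℕ) : ℝ) * τ = θ + k * τ + τ := by
            push_cast
            ring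
          rw [e, hstep, ihk]
          push_cast
          ring
      have hd0 : ((d ^ (n + 1) : ℕ) : ℝ) ≠ 0 := by
        have : d ^ (n + 1) ≠ 0 := pow_ne_zero _ (by omega)
        exact_mod_cast this
      have h1 := hmul (d ^ (n + 1)) 0
      have e1 : ((d ^ (n + 1) : ℕ) : ℝ) * τ = 1 := by
        rw [hτ, ← Nat.cast_pow]
        field_simp
      rw [e1, hφp 0] at h1
      have hc0 : c / w 0 = 0 := by
        have : ((d ^ (n + 1) : ℕ) : ℝ) * (c / w 0) = 0 := by linarith
        exact (mul_eq_zero.1 this).resolve_left hd0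
      intro θ
      rw [hstep, hc0, add_zero]
  obtain ⟨s, t, hst⟩ := hφnc
  exact hst ((Function.Periodic.const_of_inv_pow hφc hd hall s).trans
    (Function.Periodic.const_of_inv_pow hφc hd hall t).symm)

/-- Uniform version of `volume_weightedSum_mem_lt` for a bounded number of small windows. -/
theorem exists_volume_weightedSum_near_le (hφa : ∀ x, AnalyticAt ℝ φ x)
    (hφp : Function.Periodic φ 1) (hφnc : ∃ s t : ℝ, φ s ≠ φ t) (hφb : ∀ θ, |φ θ| ≤ 1)
    (hd : 2 ≤ d) (hw : Summable fun j => |w j|) (hw0 : w 0 ≠ 0) (ι : Type*) [Finite ι] :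
    ∃ ε > 0, ∀ t : ι → ℝ, (∀ i, t i ∈ Icc (0 : ℝ) 1) →
      volume ({θ : ℝ | ∃ i, |∑' j, w j * φ ((d : ℝ) ^ j * θ) -
        ∑' j, w j * φ ((d : ℝ) ^ j * t i)| ≤ ε} ∩ Ico 0 1) ≤ 2 / 3 := by
  have := Fintype.ofFinite ι
  have hφc : Continuous φ := continuous_iff_continuousAt.2 fun x => (hφa x).continuousAt
  set T : ℝ → ℝ := fun θ : ℝ => ∑' j, w j * φ ((d : ℝ) ^ j * θ) with hT
  have hTc : Continuous T := continuous_weightedSum hφc hφb hw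
  by_contra! hcon
  have hpos : ∀ n : ℕ, 0 < 1 / ((n : ℝ) + 1) := fun n => Nat.one_div_pos_of_nat
  choose t ht hvol using fun n : ℕ => hcon _ (hpos n)
  obtain ⟨x, -, ψ, hψ, hlim⟩ := (isCompact_univ_pi fun _ : ι => isCompact_Icc).tendsto_subseq
    (x := t) fun n i _ => ht n i
  set A : ℕ → Set ℝ := fun k => {θ : ℝ | ∃ i, |T θ - T (x i)| ≤ 1 / ((k : ℝ) + 1)} ∩ Ico 0 1
    with hA
  have hAvol : ∀ k, 2 / 3 ≤ volume (A k) := by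
    intro k
    have h1 : ∀ᶠ n in atTop, ∀ i, |T (t (ψ n) i) - T (x i)| < 1 / ((k : ℝ) + 1) / 2 := by
      refine eventually_all.2 fun i => ?_
      have h2 : Tendsto (fun n => T (t (ψ n) i)) atTop (nhds (T (x i))) :=
        (hTc.tendsto _).comp ((tendsto_pi_nhds.1 hlim) i)
      simpa [Real.dist_eq] using (Metric.tendsto_nhds.1 h2) _ (half_pos (hpos k))
    have h2 : ∀ᶠ n in atTop, 1 / ((ψ n : ℝ) + 1) < 1 / ((k : ℝ) + 1) / 2 :=
      (tendsto_one_div_add_atTop_nhds_zero_nat.comp hψ.tendsto_atTop).eventually_lt_const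
        (half_pos (hpos k))
    obtain ⟨n, hn1, hn2⟩ := (h1.and h2).exists
    refine (hvol (ψ n)).le.trans (measure_mono ?_)
    rintro θ ⟨⟨i, hi⟩, hθ⟩
    refine ⟨⟨i, ?_⟩, hθ⟩
    have := abs_sub_le (T θ) (T (t (ψ n) i)) (T (x i))
    have := hn1 i
    have hi' : |T θ - T (t (ψ n) i)| ≤ _ := hi
    linarith
  have hAm : ∀ k, MeasurableSet (A k) := by
    intro k
    refine MeasurableSet.inter ?_ measurableSet_Ico
    rw [ofPred_exists]
    refine MeasurableSet.iUnion fun i => ?_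
    exact (isClosed_le (by fun_prop) continuous_const).measurableSet
  have hanti : Antitone A := by
    intro k l hkl θ hθ
    obtain ⟨⟨i, hi⟩, h⟩ := hθ
    exact ⟨⟨i, hi.trans (Nat.one_div_le_one_div hkl)⟩, h⟩
  have hfin : volume (A 0) ≠ ⊤ :=
    ((measure_mono inter_subset_right).trans_lt (by simp : volume (Ico (0 : ℝ) 1) < ⊤)).ne
  have hinter := tendsto_measure_iInter_atTop (μ := volume)
    (fun k => (hAm k).nullMeasurableSet) hanti ⟨0, hfin⟩
  have hge : (2 / 3 : ℝ≥0∞) ≤ volume (⋂ k, A k) := ge_of_tendsto' hinter hAvol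
  refine absurd (hge.trans (measure_mono ?_))
    (volume_weightedSum_mem_lt hφa hφp hφnc hφb hd hw hw0
      (finite_range fun i => T (x i))).not_ge
  intro θ hθ
  rw [mem_iInter] at hθ
  refine ⟨?_, (hθ 0).2⟩
  by_contra hne
  have hne' : ∀ i, 0 < |T θ - T (x i)| := fun i =>
    abs_pos.2 (sub_ne_zero.2 fun h => hne ⟨i, h.symm⟩)
  have hev : ∀ᶠ k : ℕ in atTop, ∀ i, 1 / ((k : ℝ) + 1) < |T θ - T (x i)| :=
    eventually_all.2 fun i =>
      tendsto_one_div_add_atTop_nhds_zero_nat.eventually_lt_const (hne' i)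
  obtain ⟨k, hk⟩ := hev.exists
  obtain ⟨⟨i, hi⟩, -⟩ := hθ k
  exact absurd hi (hk i).not_ge

end WeightedSum

theorem Finset.abs_prod_div_prod_sub_one_le {s g L : ℕ → ℝ} {ξ : ℝ} (hξ : 0 < ξ)
    (hg : ∀ i, 4 * ξ ≤ |g i|) {n : ℕ} (hs : ∀ i < n, |s i - g i| ≤ 2 * L i)
    (hL : ∑ i ∈ Finset.range n, L i ≤ ξ) :
    |(∏ i ∈ Finset.range n, s i) / (∏ i ∈ Finset.range n, g i) - 1| ≤
        (∑ i ∈ Finset.range n, L i) / ξ ∧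
      |(∏ i ∈ Finset.range n, s i) / (∏ i ∈ Finset.range n, g i) - 1| ≤ 2 / 3 := by
  have hg0 : ∀ i, 0 < |g i| := fun i => by linarith [hg i]
  have hε : ∀ i ∈ Finset.range n, ‖s i / g i - 1‖ ≤ L i / (2 * ξ) := by
    intro i hi
    have h := hs i (Finset.mem_range.1 hi)
    have e : s i / g i - 1 = (s i - g i) / g i := by
      have := abs_pos.1 (hg0 i)
      field_simp
    rw [Real.norm_eq_abs, e, abs_div, div_le_div_iff₀ (hg0 i) (by positivity)]
    nlinarith [hg i, abs_nonneg (s i - g i)]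
  set S : ℝ := ∑ i ∈ Finset.range n, ‖s i / g i - 1‖ with hS
  have hS0 : 0 ≤ S := Finset.sum_nonneg fun i _ => norm_nonneg _
  have hSL : S ≤ (∑ i ∈ Finset.range n, L i) / (2 * ξ) := by
    rw [Finset.sum_div]
    exact Finset.sum_le_sum hε
  have hS1 : S ≤ 1 / 2 := by
    refine hSL.trans ?_
    rw [div_le_div_iff₀ (by positivity) (by norm_num)]
    linarith
  have hR : |(∏ i ∈ Finset.range n, s i) / (∏ i ∈ Finset.range n, g i) - 1| ≤ Real.exp S - 1 := by
    have := Finset.norm_prod_one_add_sub_one_le (Finset.range n) fun i => s i / g i - 1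
    simpa [Finset.prod_div_distrib, hS] using this
  constructor
  · refine hR.trans ?_
    have h1 := Real.abs_exp_sub_one_le (x := S) (by rw [abs_of_nonneg hS0]; linarith)
    rw [abs_of_nonneg hS0] at h1
    have h2 : 2 * S ≤ (∑ i ∈ Finset.range n, L i) / ξ := by
      calc 2 * S ≤ 2 * ((∑ i ∈ Finset.range n, L i) / (2 * ξ)) := by linarith
        _ = _ := by field_simp
    linarith [le_abs_self (Real.exp S - 1)]
  · refine hR.trans ?_
    have h1 : Real.exp S ≤ Real.exp (1 / 2) := Real.exp_le_exp.2 hS1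
    have h2 : Real.exp (1 / 2) * Real.exp (1 / 2) = Real.exp 1 := by
      rw [← Real.exp_add]
      norm_num
    have h3 := Real.exp_one_lt_d9
    have h4 : Real.exp (1 / 2) ≤ 5 / 3 := by
      by_contra! h
      nlinarith
    linarith

theorem affine_recursion_eq {s δ e : ℕ → ℝ} {η α : ℝ} (h0 : δ 0 = η + α * e 0) {N : ℕ}
    (h : ∀ n < N, δ (n + 1) = s n * δ n + α * e (n + 1))
    (hs : ∀ n < N, s n ≠ 0) {n : ℕ} (hn : n ≤ N) :
    δ n = (∏ i ∈ Finset.range n, s i) *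
      (η + α * ∑ j ∈ Finset.range (n + 1), e j * (∏ i ∈ Finset.range j, s i)⁻¹) := by
  induction n with
  | zero => simp [h0]
  | succ n ih =>
    have hQ : ∏ i ∈ Finset.range (n + 1), s i ≠ 0 :=
      Finset.prod_ne_zero_iff.2 fun i hi => hs i (by have := Finset.mem_range.1 hi; omega)
    rw [h n (by omega), ih (by omega),
      Finset.sum_range_succ (fun j => e j * (∏ i ∈ Finset.range j, s i)⁻¹) (n + 1)]
    rw [Finset.prod_range_succ] at hQ ⊢
    have hP := left_ne_zero_of_mul hQ
    have hsn := right_ne_zero_of_mul hQ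
    generalize ∏ i ∈ Finset.range n, s i = P at hP ⊢
    generalize ∑ j ∈ Finset.range (n + 1), e j * (∏ i ∈ Finset.range j, s i)⁻¹ = S
    field_simp
    ring

/-- If the linearised and the true derivative cocycles along an orbit segment are close, the
difference `δ N` of two orbits controls the linearised displacement. -/
theorem abs_tsum_le_of_affine_recursion {g L s δ e : ℕ → ℝ} {ξ r c K α η : ℝ} {N : ℕ}
    (hξ : 0 < ξ) (hr : 1 < r) (hc : 0 < c) (hK : 0 < K) (hα : 0 < α)
    (hD : ∀ n, c * r ^ n ≤ |∏ i ∈ Finset.range n, g i|) (hg : ∀ i, 4 * ξ ≤ |g i|)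
    (hL0 : ∀ i, 0 ≤ L i) (hLs : ∑ i ∈ Finset.range N, L i ≤ ξ)
    (hLK : ∀ n ≤ N, ∑ i ∈ Finset.range n, L i ≤ K * α * r ^ n) (hN : ξ ≤ K * α * r ^ N)
    (hs : ∀ i < N, |s i - g i| ≤ 2 * L i) (h0 : δ 0 = η + α * e 0)
    (hrec : ∀ n < N, δ (n + 1) = s n * δ n + α * e (n + 1)) (he : ∀ j, |e j| ≤ 2) :
    |∑' j, e j * (∏ i ∈ Finset.range j, g i)⁻¹| ≤
      3 * K / (c * ξ) * |δ N| + |η| / α +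
        2 * (3 / c * √(K / ξ)) * (1 - (√r)⁻¹)⁻¹ * √α := by
  set D : ℕ → ℝ := fun n => ∏ i ∈ Finset.range n, g i with hDdef
  set Q : ℕ → ℝ := fun n => ∏ i ∈ Finset.range n, s i with hQdef
  have hr0 : 0 < r := by linarith
  have hsr : 1 < √r := Real.lt_sqrt_of_sq_lt (by simpa using hr)
  have hsr0 : 0 < √r := by linarith
  set ρ : ℝ := (√r)⁻¹ with hρ
  have hρ0 : 0 < ρ := inv_pos.2 hsr0
  have hρ1 : ρ < 1 := inv_lt_one_of_one_lt₀ hsr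
  have hρr : ρ ^ 2 = r⁻¹ := by rw [hρ, inv_pow, Real.sq_sqrt hr0.le]
  have hDpos : ∀ n, 0 < |D n| := fun n => (mul_pos hc (pow_pos hr0 n)).trans_le (hD n)
  have hDinv : ∀ n, |D n|⁻¹ ≤ c⁻¹ * (ρ ^ n) ^ 2 := by
    intro n
    rw [← pow_mul, mul_comm n, pow_mul, hρr, inv_pow, ← mul_inv]
    exact inv_anti₀ (mul_pos hc (pow_pos hr0 n)) (hD n)
  have hsum : ∀ n ≤ N, ∑ i ∈ Finset.range n, L i ≤ ξ := fun n hn =>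
    (Finset.sum_le_sum_of_subset_of_nonneg (Finset.range_mono hn) fun i _ _ => hL0 i).trans hLs
  have hR : ∀ n ≤ N, |Q n / D n - 1| ≤ (∑ i ∈ Finset.range n, L i) / ξ ∧
      |Q n / D n - 1| ≤ 2 / 3 := fun n hn =>
    Finset.abs_prod_div_prod_sub_one_le hξ hg (fun i hi => hs i (by omega)) (hsum n hn)
  have hRlow : ∀ n ≤ N, 1 / 3 ≤ |Q n / D n| := by
    intro n hn
    have h1 := (hR n hn).2
    have h2 := abs_sub_abs_le_abs_sub (1 : ℝ) (Q n / D n)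
    rw [abs_sub_comm, abs_one] at h2
    linarith
  have hQD : ∀ n ≤ N, |D n| / 3 ≤ |Q n| := by
    intro n hn
    have h1 := hRlow n hn
    rw [abs_div, le_div_iff₀ (hDpos n)] at h1
    linarith
  have hQ0 : ∀ n ≤ N, Q n ≠ 0 := fun n hn =>
    abs_pos.1 ((div_pos (hDpos n) three_pos).trans_le (hQD n hn))
  have hs0 : ∀ n < N, s n ≠ 0 := by
    intro n hn h
    refine hQ0 (n + 1) hn ?_
    simp only [hQdef, Finset.prod_range_succ, h, mul_zero]
  set b : ℕ → ℝ := fun j => if j ≤ N then (Q j)⁻¹ else 0 with hb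
  set A : ℝ := 3 / c * √(K / ξ) with hA
  have hA0 : 0 ≤ A := by positivity
  have hKξ : √(K / ξ) * √α = √(K / ξ * α) := (Real.sqrt_mul (by positivity) _).symm
  have hbD : ∀ j, |b j - (D j)⁻¹| ≤ A * √α * ρ ^ j := by
    intro j
    by_cases hj : j ≤ N
    · have hbj : b j = (Q j)⁻¹ := if_pos hj
      have hDj := abs_pos.1 (hDpos j)
      have hQj := hQ0 j hj
      have e1 : (Q j)⁻¹ - (D j)⁻¹ = (D j)⁻¹ * (Q j / D j)⁻¹ * (1 - Q j / D j) := by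
        field_simp
      obtain ⟨h1, h2⟩ := hR j hj
      have h3 : |Q j / D j - 1| ≤ √(K / ξ * α) * √r ^ j := by
        have hy : |Q j / D j - 1| ≤ K / ξ * α * r ^ j := by
          refine h1.trans ?_
          rw [div_le_iff₀ hξ]
          refine (hLK j hj).trans (le_of_eq ?_)
          field_simp
        have e2 : √(K / ξ * α) * √r ^ j = √(K / ξ * α * r ^ j) := by
          rw [Real.sqrt_mul (x := K / ξ * α) (by positivity) (r ^ j), Real.sqrt_eq_rpow (r ^ j), Real.sqrt_eq_rpow r,
            ← Real.rpow_natCast, ← Real.rpow_natCast, ← Real.rpow_mul hr0.le,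
            ← Real.rpow_mul hr0.le, mul_comm (1 / 2 : ℝ)]
        rw [e2]
        refine Real.le_sqrt_of_sq_le (le_trans ?_ hy)
        nlinarith [abs_nonneg (Q j / D j - 1)]
      have h4 : |(Q j / D j)⁻¹| ≤ 3 := by
        rw [abs_inv]
        exact inv_le_of_inv_le₀ (by norm_num) (by linarith [hRlow j hj])
      rw [hbj, e1, abs_mul, abs_mul, abs_inv, abs_sub_comm]
      calc |D j|⁻¹ * |(Q j / D j)⁻¹| * |Q j / D j - 1|
          ≤ (c⁻¹ * (ρ ^ j) ^ 2) * 3 * (√(K / ξ * α) * √r ^ j) := by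
            gcongr
            exact hDinv j
        _ = 3 / c * √(K / ξ * α) * ρ ^ j * (ρ * √r) ^ j := by
            rw [mul_pow]
            ring
        _ = A * √α * ρ ^ j := by
            rw [hρ, inv_mul_cancel₀ hsr0.ne', one_pow, ← hKξ, hA]
            ring
    · have hbj : b j = 0 := if_neg hj
      rw [hbj, zero_sub, abs_neg, abs_inv]
      have h1 : ρ ^ N ≤ √(K / ξ * α) := by
        refine Real.le_sqrt_of_sq_le ?_
        rw [← pow_mul, mul_comm N, pow_mul, hρr, inv_pow]
        refine inv_le_of_inv_le₀ (by positivity) ?_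
        have e2 : K / ξ * α * r ^ N = K * α * r ^ N / ξ := by ring
        rw [← one_div, div_le_iff₀ (by positivity), mul_comm, e2, le_div_iff₀ hξ]
        linarith
      have h2 : ρ ^ j ≤ ρ ^ N := pow_le_pow_of_le_one hρ0.le hρ1.le (by omega)
      calc |D j|⁻¹ ≤ c⁻¹ * (ρ ^ j) ^ 2 := hDinv j
        _ ≤ c⁻¹ * (ρ ^ j * √(K / ξ * α)) := by
            rw [sq]
            gcongr
            exact h2.trans h1
        _ ≤ 3 * (c⁻¹ * (ρ ^ j * √(K / ξ * α))) := by
            have : 0 ≤ c⁻¹ * (ρ ^ j * √(K / ξ * α)) := by positivity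
            linarith
        _ = A * √α * ρ ^ j := by
            rw [← hKξ, hA]
            ring
  have hgeo : HasSum (fun j => 2 * (A * √α) * ρ ^ j) (2 * (A * √α) * (1 - ρ)⁻¹) :=
    (hasSum_geometric_of_lt_one hρ0.le hρ1).mul_left _
  have hterm : ∀ j, ‖e j * (D j)⁻¹ - e j * b j‖ ≤ 2 * (A * √α) * ρ ^ j := by
    intro j
    rw [← mul_sub, Real.norm_eq_abs, abs_mul, abs_sub_comm (D j)⁻¹, mul_assoc 2]
    exact mul_le_mul (he j) (hbD j) (abs_nonneg _) two_pos.le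
  have hdiff : Summable fun j => e j * (D j)⁻¹ - e j * b j :=
    Summable.of_norm_bounded hgeo.summable hterm
  have hbfin : HasSum (fun j => e j * b j) (∑ j ∈ Finset.range (N + 1), e j * (Q j)⁻¹) := by
    have h1 : ∑ j ∈ Finset.range (N + 1), e j * (Q j)⁻¹ =
        ∑ j ∈ Finset.range (N + 1), e j * b j := by
      refine Finset.sum_congr rfl fun j hj => ?_
      have : j ≤ N := by have := Finset.mem_range.1 hj; omega
      simp only [hb, if_pos this]
    rw [h1]
    refine hasSum_sum_of_ne_finset_zero fun j hj => ?_
    have : ¬ j ≤ N := fun h => hj (Finset.mem_range.2 (by omega))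
    simp only [hb, if_neg this, mul_zero]
  have htot : ∑' j, e j * (D j)⁻¹ = ∑' j, (e j * (D j)⁻¹ - e j * b j) +
      ∑ j ∈ Finset.range (N + 1), e j * (Q j)⁻¹ := by
    rw [← (hdiff.hasSum.add hbfin).tsum_eq]
    simp
  have herr : |∑' j, (e j * (D j)⁻¹ - e j * b j)| ≤ 2 * (A * √α) * (1 - ρ)⁻¹ :=
    tsum_of_norm_bounded hgeo hterm
  have hδ := affine_recursion_eq h0 hrec hs0 le_rfl
  have hQN := hQ0 N le_rfl
  have hfin : ∑ j ∈ Finset.range (N + 1), e j * (Q j)⁻¹ = δ N / (α * Q N) - η / α := by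
    rw [hδ]
    change _ = Q N * (η + α * ∑ j ∈ Finset.range (N + 1), e j * (Q j)⁻¹) / (α * Q N) - η / α
    field_simp
    ring
  have hαQ : |δ N / (α * Q N)| ≤ 3 * K / (c * ξ) * |δ N| := by
    rw [abs_div, div_eq_mul_inv, mul_comm]
    refine mul_le_mul_of_nonneg_right ?_ (abs_nonneg _)
    rw [abs_mul, abs_of_pos hα, ← inv_div]
    refine inv_anti₀ (by positivity) ?_
    rw [div_le_iff₀ (by positivity)]
    have h1 := hQD N le_rfl
    have h2 := hD N
    have h3 : c * r ^ N / 3 ≤ |Q N| := by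
      have : |∏ i ∈ Finset.range N, g i| = |D N| := rfl
      linarith
    calc c * ξ ≤ c * (K * α * r ^ N) := by gcongr
      _ = α * (c * r ^ N / 3) * (3 * K) := by ring
      _ ≤ α * |Q N| * (3 * K) := by gcongr
  rw [htot, hfin]
  calc |∑' j, (e j * (D j)⁻¹ - e j * b j) + (δ N / (α * Q N) - η / α)|
      ≤ |∑' j, (e j * (D j)⁻¹ - e j * b j)| + (|δ N / (α * Q N)| + |η / α|) :=
        (abs_add_le _ _).trans (by gcongr; exact abs_sub _ _)
    _ ≤ 2 * (A * √α) * (1 - ρ)⁻¹ + (3 * K / (c * ξ) * |δ N| + |η| / α) := by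
        rw [abs_div η, abs_of_pos hα]
        gcongr
    _ = _ := by ring

section ShadowingIntervals

variable {a α : ℝ}

theorem continuous_qm (a : ℝ) : Continuous (qm a) := by
  unfold qm
  fun_prop

theorem qm_add_mem_IEnd_succ {n : ℕ} {x s : ℝ} (hx : x ∈ Icc (IEnd a α n).1 (IEnd a α n).2)
    (hs : |s| ≤ α) : qm a x + s ∈ Icc (IEnd a α (n + 1)).1 (IEnd a α (n + 1)).2 := by
  have hc : IsCompact (qm a '' Icc (IEnd a α n).1 (IEnd a α n).2) :=
    isCompact_Icc.image (continuous_qm a)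
  have h1 := csInf_le hc.bddBelow (mem_image_of_mem (qm a) hx)
  have h2 := le_csSup hc.bddAbove (mem_image_of_mem (qm a) hx)
  obtain ⟨h3, h4⟩ := abs_le.1 hs
  constructor
  · simp only [IEnd]
    linarith
  · simp only [IEnd]
    linarith

theorem iterate_mem_IEnd (hα : 0 ≤ α) (n : ℕ) :
    (qm a)^[n + 1] 0 ∈ Icc (IEnd a α n).1 (IEnd a α n).2 := by
  induction n with
  | zero => constructor <;> simp [IEnd, hα]
  | succ n ih =>
    rw [Function.iterate_succ_apply']
    simpa using qm_add_mem_IEnd_succ ih (s := 0) (by simpa using hα)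

theorem abs_sub_le_len {n : ℕ} {x y : ℝ} (hx : x ∈ Icc (IEnd a α n).1 (IEnd a α n).2)
    (hy : y ∈ Icc (IEnd a α n).1 (IEnd a α n).2) : |x - y| ≤ len a α n := by
  rw [len, abs_le]
  constructor <;> linarith [hx.1, hx.2, hy.1, hy.2]

theorem len_nonneg (hα : 0 ≤ α) (n : ℕ) : 0 ≤ len a α n :=
  (abs_nonneg _).trans (abs_sub_le_len (iterate_mem_IEnd hα n) (iterate_mem_IEnd hα n))

theorem two_mul_le_len (hα : 0 ≤ α) (n : ℕ) : 2 * α ≤ len a α n := by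
  cases n with
  | zero =>
    simp only [len, IEnd]
    linarith
  | succ n =>
    have hx := iterate_mem_IEnd (a := a) hα n
    have h := abs_sub_le_len (qm_add_mem_IEnd_succ hx (s := α) (abs_of_nonneg hα).le)
      (qm_add_mem_IEnd_succ hx (s := -α) (by rw [abs_neg, abs_of_nonneg hα]))
    refine le_trans ?_ ((le_abs_self _).trans h)
    linarith

theorem len_succ_le (hα : 0 ≤ α) (n : ℕ) :
    len a α (n + 1) ≤ (|-2 * (qm a)^[n + 1] 0| + 2 * len a α n) * len a α n + 2 * α := by
  set I := Icc (IEnd a α n).1 (IEnd a α n).2 with hI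
  set c := (qm a)^[n + 1] 0 with hc
  have hcI : c ∈ I := iterate_mem_IEnd hα n
  have hcomp : IsCompact (qm a '' I) := isCompact_Icc.image (continuous_qm a)
  have hne : (qm a '' I).Nonempty := ⟨_, mem_image_of_mem _ hcI⟩
  obtain ⟨x, hx, hx'⟩ := hcomp.sSup_mem hne
  obtain ⟨y, hy, hy'⟩ := hcomp.sInf_mem hne
  have hlen : len a α (n + 1) = qm a x - qm a y + 2 * α := by
    rw [hx', hy']
    simp only [len, IEnd]
    ring
  have h1 := abs_sub_le_len hx hcI
  have h2 := abs_sub_le_len hy hcI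
  have h3 := abs_sub_le_len hy hx
  have h4 : |x + y| ≤ |-2 * c| + 2 * len a α n := by
    calc |x + y| = |-(-2 * c) + ((x - c) + (y - c))| := by
          congr 1
          ring
      _ ≤ |-(-2 * c)| + |(x - c) + (y - c)| := abs_add_le _ _
      _ ≤ |-2 * c| + (|x - c| + |y - c|) := by
          rw [abs_neg]
          gcongr
          exact abs_add_le _ _
      _ ≤ _ := by linarith
  have h5 : qm a x - qm a y ≤ |x + y| * |y - x| := by
    rw [← abs_mul]
    refine le_trans (le_of_eq ?_) (le_abs_self _)
    simp only [qm]
    ring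
  rw [hlen]
  have h6 : |x + y| * |y - x| ≤ (|-2 * c| + 2 * len a α n) * len a α n :=
    mul_le_mul h4 h3 (abs_nonneg _) ((abs_nonneg _).trans h4)
  linarith

end ShadowingIntervals

theorem le_of_quadratic_recursion {g L : ℕ → ℝ} {ξ α : ℝ} (hξ : 0 < ξ) (hα : 0 ≤ α)
    (hg : ∀ i, 4 * ξ ≤ |g i|) (hL : ∀ i, 0 ≤ L i) (h0 : L 0 = 4 * α)
    (hrec : ∀ n, L (n + 1) ≤ (|g n| + 2 * L n) * L n + 2 * α) (n : ℕ) :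
    L n ≤ 4 * α * (∏ i ∈ Finset.range n, (1 + L i / (2 * ξ))) *
      (|∏ i ∈ Finset.range n, g i| * ∑ j ∈ Finset.range (n + 1), |∏ i ∈ Finset.range j, g i|⁻¹) := by
  induction n with
  | zero => simp [h0]
  | succ n ih =>
    have hgn : 0 < |g n| := by linarith [hg n]
    have hD : 0 < |∏ i ∈ Finset.range n, g i| := abs_pos.2 <| Finset.prod_ne_zero_iff.2 fun i _ =>
      abs_pos.1 (by linarith [hg i])
    have hA : 1 ≤ ∏ i ∈ Finset.range (n + 1), (1 + L i / (2 * ξ)) := by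
      refine Finset.one_le_prod fun i _ => ?_
      have : 0 ≤ L i / (2 * ξ) := div_nonneg (hL i) (by positivity)
      linarith
    have h1 : (|g n| + 2 * L n) ≤ |g n| * (1 + L n / (2 * ξ)) := by
      have : 4 * ξ * (L n / (2 * ξ)) ≤ |g n| * (L n / (2 * ξ)) :=
        mul_le_mul_of_nonneg_right (hg n) (div_nonneg (hL n) (by positivity))
      have e : 4 * ξ * (L n / (2 * ξ)) = 2 * L n := by
        field_simp
        ring
      linarith
    have h2 : (|g n| + 2 * L n) * L n ≤ |g n| * (1 + L n / (2 * ξ)) * L n :=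
      mul_le_mul_of_nonneg_right h1 (hL n)
    have hLn : 0 ≤ L n / (2 * ξ) := div_nonneg (hL n) (by positivity)
    have h3 := mul_le_mul_of_nonneg_left ih (by positivity : 0 ≤ |g n| * (1 + L n / (2 * ξ)))
    have hsum := Finset.sum_range_succ (fun j => |∏ i ∈ Finset.range j, g i|⁻¹) (n + 1)
    rw [hsum, mul_add, mul_add,
      mul_inv_cancel₀ (by rw [Finset.prod_range_succ, abs_mul]; positivity)]
    refine (hrec n).trans (add_le_add (h2.trans (h3.trans (le_of_eq ?_))) ?_)
    · rw [Finset.prod_range_succ, Finset.prod_range_succ, abs_mul]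
      ring
    · nlinarith

/-- Up to the time of loss of control, the shadowing intervals grow like the derivative along
the critical orbit. -/
theorem exists_sum_len_le {a ξ r c C : ℝ} (hξ : 0 < ξ) (hr : 1 < r) (hc : 0 < c) (hC : 0 < C)
    (hD : ∀ n, c * r ^ n ≤ |critDeriv a n| ∧ |critDeriv a n| ≤ C * r ^ n)
    (hg : ∀ i : ℕ, 4 * ξ ≤ |-2 * (qm a)^[i + 1] 0|) :
    ∃ K > 0, ∀ α, 0 < α → ∀ N : ℕ, ∑ i ∈ Finset.range N, len a α i ≤ ξ →
      ∀ n ≤ N, ∑ i ∈ Finset.range (n + 1), len a α i ≤ K * α * r ^ n := by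
  have hr0 : 0 < r := by linarith
  have hri : r⁻¹ < 1 := inv_lt_one_of_one_lt₀ hr
  have hri' : 0 < 1 - r⁻¹ := by linarith
  have hr1 : 0 < r - 1 := by linarith
  set K₀ : ℝ := 8 * (C * (c⁻¹ * (1 - r⁻¹)⁻¹)) with hK₀
  have hK₀' : 0 < K₀ := by positivity
  refine ⟨K₀ * (r / (r - 1)), by positivity, fun α hα N hN n hn => ?_⟩
  have hsub : ∀ n ≤ N, ∑ i ∈ Finset.range n, len a α i ≤ ξ := fun n hn =>
    (Finset.sum_le_sum_of_subset_of_nonneg (Finset.range_mono hn)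
      fun i _ _ => len_nonneg hα.le i).trans hN
  have hlen : ∀ n ≤ N, len a α n ≤ K₀ * α * r ^ n := by
    intro n hn
    refine (le_of_quadratic_recursion hξ hα.le hg (len_nonneg hα.le)
      (by simp only [len, IEnd]; ring) (len_succ_le hα.le) n).trans ?_
    have hP : ∏ i ∈ Finset.range n, (1 + len a α i / (2 * ξ)) ≤ 2 := by
      have h1 : ∏ i ∈ Finset.range n, (1 + len a α i / (2 * ξ)) ≤
          ∏ i ∈ Finset.range n, Real.exp (len a α i / (2 * ξ)) := by
        refine Finset.prod_le_prod (fun i _ => ?_) fun i _ => ?_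
        · have : 0 ≤ len a α i / (2 * ξ) := div_nonneg (len_nonneg hα.le i) (by positivity)
          linarith
        · rw [add_comm]
          exact Real.add_one_le_exp _
      refine h1.trans ?_
      rw [← Real.exp_sum, ← Finset.sum_div]
      have h2 : (∑ i ∈ Finset.range n, len a α i) / (2 * ξ) ≤ 1 / 2 := by
        rw [div_le_div_iff₀ (by positivity) (by norm_num)]
        linarith [hsub n hn]
      refine (Real.exp_le_exp.2 h2).trans ?_
      have h3 : Real.exp (1 / 2) * Real.exp (1 / 2) = Real.exp 1 := by
        rw [← Real.exp_add]
        norm_num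
      have h4 := Real.exp_one_lt_d9
      by_contra! h
      nlinarith
    have hS : ∑ j ∈ Finset.range (n + 1), |∏ i ∈ Finset.range j, (-2 * (qm a)^[i + 1] 0)|⁻¹ ≤
        c⁻¹ * (1 - r⁻¹)⁻¹ := by
      have h1 : ∀ j ∈ Finset.range (n + 1),
          |∏ i ∈ Finset.range j, (-2 * (qm a)^[i + 1] 0)|⁻¹ ≤ c⁻¹ * r⁻¹ ^ j := fun j _ => by
        rw [inv_pow, ← mul_inv]
        exact inv_anti₀ (by positivity) (hD j).1
      refine (Finset.sum_le_sum h1).trans ?_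
      rw [← Finset.mul_sum]
      refine mul_le_mul_of_nonneg_left ?_ (by positivity)
      rw [← tsum_geometric_of_lt_one (by positivity) hri]
      exact (summable_geometric_of_lt_one (by positivity) hri).sum_le_tsum _
        fun j _ => by positivity
    calc _ ≤ 4 * α * 2 * ((C * r ^ n) * (c⁻¹ * (1 - r⁻¹)⁻¹)) := by
          gcongr
          exact (hD n).2
      _ = K₀ * α * r ^ n := by
          rw [hK₀]
          ring
  calc ∑ i ∈ Finset.range (n + 1), len a α i
      ≤ ∑ i ∈ Finset.range (n + 1), K₀ * α * r ^ i := Finset.sum_le_sum fun i hi =>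
        hlen i (by have := Finset.mem_range.1 hi; omega)
    _ = K₀ * α * ((r ^ (n + 1) - 1) / (r - 1)) := by
        rw [← Finset.mul_sum, geom_sum_eq hr.ne']
    _ ≤ K₀ * α * (r ^ (n + 1) / (r - 1)) := by
        gcongr
        linarith
    _ = K₀ * (r / (r - 1)) * α * r ^ n := by
        rw [pow_succ]
        ring

theorem Nal_spec {a ξ α : ℝ} (hξ : 0 ≤ ξ) (hα : 0 < α) :
    (∀ n < Nal a ξ α, len a α n < ξ) ∧ ∑ n ∈ Finset.range (Nal a ξ α), len a α n ≤ ξ ∧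
      ξ ≤ ∑ n ∈ Finset.range (Nal a ξ α + 1), len a α n := by
  set S : Set ℕ := {N : ℕ | (∀ n : ℕ, 1 ≤ n → n ≤ N → len a α (n - 1) < ξ) ∧
    ∑ n ∈ Finset.range N, len a α n ≤ ξ} with hS
  have hne : S.Nonempty := ⟨0, fun n h1 h2 => by omega, by simpa using hξ⟩
  have hbdd : BddAbove S := by
    obtain ⟨k, hk⟩ := exists_nat_gt (ξ / (2 * α))
    refine ⟨k, fun N hN => ?_⟩
    have h1 : (N : ℝ) * (2 * α) ≤ ξ := by
      calc (N : ℝ) * (2 * α) = ∑ n ∈ Finset.range N, 2 * α := by simp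
        _ ≤ _ := Finset.sum_le_sum fun n _ => two_mul_le_len hα.le n
        _ ≤ ξ := hN.2
    have h2 : (N : ℝ) ≤ ξ / (2 * α) := (le_div_iff₀ (by positivity)).2 h1
    exact_mod_cast (h2.trans hk.le)
  have hmem : Nal a ξ α ∈ S := Nat.sSup_mem hne hbdd
  refine ⟨fun n hn => hmem.1 (n + 1) (by omega) (by omega), hmem.2, ?_⟩
  by_contra! hlt
  have : Nal a ξ α + 1 ∈ S := by
    refine ⟨fun n h1 h2 => ?_, hlt.le⟩
    refine lt_of_le_of_lt ?_ hlt
    exact Finset.single_le_sum (fun i _ => len_nonneg hα.le i) (Finset.mem_range.2 (by omega))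
  have h := le_csSup hbdd this
  have h' : Nal a ξ α + 1 ≤ Nal a ξ α := h
  omega

theorem exists_forall_le_of_contracting_recursion {g : ℕ → ℝ} {ξ r c C : ℝ} (hξ : 0 < ξ)
    (hr0 : 0 < r) (hr : r < 1) (hc : 0 < c) (hC : 0 < C)
    (hD : ∀ n, c * r ^ n ≤ |∏ i ∈ Finset.range n, g i| ∧
      |∏ i ∈ Finset.range n, g i| ≤ C * r ^ n) :
    ∃ α₀ > 0, ∀ α, 0 < α → α < α₀ → ∀ u : ℕ → ℝ, (∀ n, 0 ≤ u n) → u 0 ≤ 2 * α →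
      (∀ n, u (n + 1) ≤ (|g n| + u n) * u n + α) → ∀ n, u n ≤ ξ := by
  have hr1 : 0 < 1 - r := by linarith
  set η : ℝ := min (ξ / C) ((1 - r) * c / (2 * C ^ 2)) with hη
  have hη0 : 0 < η := lt_min (by positivity) (by positivity)
  refine ⟨min (η / 2) (c * (1 - r) * η / 2), lt_min (by positivity) (by positivity),
    fun α hα hα' u hu h0 hrec n => ?_⟩
  have hα1 : α ≤ η / 2 := hα'.le.trans (min_le_left _ _)
  have hα2 : α ≤ c * (1 - r) * η / 2 := hα'.le.trans (min_le_right _ _)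
  set D : ℕ → ℝ := fun n => |∏ i ∈ Finset.range n, g i| with hDdef
  have hDpos : ∀ n, 0 < D n := fun n => (mul_pos hc (pow_pos hr0 n)).trans_le (hD n).1
  have hDsucc : ∀ n, D (n + 1) = D n * |g n| := fun n => by
    simp only [hDdef, Finset.prod_range_succ, abs_mul]
  have hgpos : ∀ n, 0 < |g n| := fun n =>
    pos_of_mul_pos_right (hDsucc n ▸ hDpos (n + 1)) (hDpos n).le
  have huC : ∀ n, u n * r ^ n ≤ η * D n → u n ≤ C * η := by
    intro n h
    have h1 : u n * r ^ n ≤ C * η * r ^ n := by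
      nlinarith [mul_le_mul_of_nonneg_left (hD n).2 hη0.le]
    exact le_of_mul_le_mul_right h1 (pow_pos hr0 n)
  have key : ∀ n, u n * r ^ n ≤ η * D n := by
    intro n
    induction n with
    | zero =>
      simp only [hDdef, pow_zero, Finset.range_zero, Finset.prod_empty, abs_one]
      linarith
    | succ n ih =>
      have h1 := huC n ih
      have hrn := pow_pos hr0 n
      have h2 : u n ^ 2 + α ≤ c * (1 - r) * η := by
        have hη2 : η ≤ (1 - r) * c / (2 * C ^ 2) := min_le_right _ _
        rw [le_div_iff₀ (by positivity)] at hη2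
        have h3 : u n ^ 2 ≤ (C * η) ^ 2 := pow_le_pow_left₀ (hu n) h1 2
        nlinarith [mul_le_mul_of_nonneg_left hη2 hη0.le]
      have h4 : u (n + 1) ≤ |g n| * u n + c * (1 - r) * η := by
        nlinarith [hrec n]
      have h5 : (c * (1 - r) * η) * r ^ (n + 1) ≤ (1 - r) * η * D (n + 1) := by
        nlinarith [mul_le_mul_of_nonneg_left (hD (n + 1)).1 (by positivity : 0 ≤ (1 - r) * η)]
      have h6 : |g n| * u n * r ^ (n + 1) ≤ r * η * D (n + 1) := by
        rw [hDsucc, pow_succ]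
        nlinarith [mul_le_mul_of_nonneg_left ih (mul_nonneg (hgpos n).le hr0.le)]
      calc u (n + 1) * r ^ (n + 1) ≤ (|g n| * u n + c * (1 - r) * η) * r ^ (n + 1) := by gcongr
        _ ≤ η * D (n + 1) := by linarith
  have hηξ : η ≤ ξ / C := min_le_left _ _
  rw [le_div_iff₀ hC] at hηξ
  linarith [huC n (key n)]

section FibreMaps

variable {a : ℝ} {d : ℕ} {φ : ℝ → ℝ} {α : ℝ}

theorem fn_succ (n : ℕ) (θ x : ℝ) :
    fn a d φ α (n + 1) θ x = fn a d φ α n (d * θ) (qm a x + α * φ θ) := rfl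

theorem fn_add (k n : ℕ) (θ x : ℝ) :
    fn a d φ α (k + n) θ x = fn a d φ α k ((d : ℝ) ^ n * θ) (fn a d φ α n θ x) := by
  induction n generalizing θ x with
  | zero => simp [fn]
  | succ n ih =>
    rw [← add_assoc, fn_succ, ih, fn_succ]
    congr 1
    ring

theorem fn_succ' (n : ℕ) (θ x : ℝ) :
    fn a d φ α (n + 1) θ x = qm a (fn a d φ α n θ x) + α * φ ((d : ℝ) ^ n * θ) := by
  rw [add_comm, fn_add]
  rfl

/-- Points with a small image under `f_k` lie close to the (finite) set `f⁻ᵏ(0)`. -/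
theorem exists_finset_near_of_abs_fn_lt (a : ℝ) (d : ℕ) (hφb : ∀ θ, |φ θ| ≤ 1) (k : ℕ) :
    ∃ E : Finset ℝ, ∀ δ > 0, ∃ σ > 0, ∃ α₀ > 0, ∀ α, 0 < α → α < α₀ → ∀ θ x,
      |fn a d φ α k θ x| < σ → ∃ z ∈ E, |x - z| < δ := by
  classical
  induction k with
  | zero => exact ⟨{0}, fun δ hδ => ⟨δ, hδ, 1, one_pos, fun α _ _ θ x h =>
      ⟨0, Finset.mem_singleton_self 0, by simpa [fn] using h⟩⟩⟩
  | succ k ih =>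
    obtain ⟨E, hE⟩ := ih
    refine ⟨E.image (fun z => √(a - z)) ∪ E.image (fun z => -√(a - z)), fun δ hδ => ?_⟩
    obtain ⟨σ, hσ, α₀, hα₀, h⟩ := hE (δ ^ 2 / 2) (by positivity)
    refine ⟨σ, hσ, min α₀ (δ ^ 2 / 2), lt_min hα₀ (by positivity), fun α hα hα' θ x hx => ?_⟩
    obtain ⟨z, hz, hxz⟩ := h α hα (hα'.trans_le (min_le_left _ _)) _ _ hx
    have hα2 : α < δ ^ 2 / 2 := hα'.trans_le (min_le_right _ _)
    have hφ : |α * φ θ| ≤ α := by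
      rw [abs_mul, abs_of_pos hα]
      exact mul_le_of_le_one_right hα.le (hφb θ)
    have hw : |x ^ 2 - (a - z)| < δ ^ 2 := by
      have e : x ^ 2 - (a - z) = -(qm a x + α * φ θ - z) + α * φ θ := by
        simp only [qm]
        ring
      rw [e]
      refine (abs_add_le _ _).trans_lt ?_
      rw [abs_neg]
      linarith
    rw [abs_lt] at hw
    by_contra! hcon
    have h1 := hcon (√(a - z)) (Finset.mem_union_left _ (Finset.mem_image_of_mem _ hz))
    have h2 := hcon (-√(a - z)) (Finset.mem_union_right _
      (Finset.mem_image_of_mem (fun z => -√(a - z)) hz))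
    have h3 : δ ^ 2 ≤ |x ^ 2 - √(a - z) ^ 2| := by
      have e : x ^ 2 - √(a - z) ^ 2 = (x - √(a - z)) * (x - -√(a - z)) := by ring
      rw [e, abs_mul, sq]
      exact mul_le_mul h1 h2 hδ.le (abs_nonneg _)
    rcases le_total 0 (a - z) with h0 | h0
    · rw [Real.sq_sqrt h0] at h3
      exact absurd (abs_lt.2 hw) h3.not_gt
    · rw [Real.sqrt_eq_zero_of_nonpos h0, zero_pow two_ne_zero, sub_zero,
        abs_of_nonneg (sq_nonneg x)] at h3
      linarith [hw.2]

theorem exists_finset_near_of_abs_fn_lt_of_lt (a : ℝ) (d : ℕ) (hφb : ∀ θ, |φ θ| ≤ 1) (M : ℕ) :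
    ∃ E : Finset ℝ, ∀ δ > 0, ∃ σ > 0, ∃ α₀ > 0, ∀ α, 0 < α → α < α₀ → ∀ k < M, ∀ θ x,
      |fn a d φ α k θ x| < σ → ∃ z ∈ E, |x - z| < δ := by
  classical
  induction M with
  | zero => exact ⟨∅, fun δ _ => ⟨1, one_pos, 1, one_pos, fun α _ _ k hk => by omega⟩⟩
  | succ M ih =>
    obtain ⟨E, hE⟩ := ih
    obtain ⟨E', hE'⟩ := exists_finset_near_of_abs_fn_lt a d hφb M
    refine ⟨E ∪ E', fun δ hδ => ?_⟩
    obtain ⟨σ, hσ, α₀, hα₀, h⟩ := hE δ hδ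
    obtain ⟨σ', hσ', α₀', hα₀', h'⟩ := hE' δ hδ
    refine ⟨min σ σ', lt_min hσ hσ', min α₀ α₀', lt_min hα₀ hα₀', fun α hα hα' k hk θ x hx => ?_⟩
    rcases Nat.lt_succ_iff_lt_or_eq.1 hk with hk | rfl
    · obtain ⟨z, hz, hxz⟩ := h α hα (hα'.trans_le (min_le_left _ _)) k hk θ x
        (hx.trans_le (min_le_left _ _))
      exact ⟨z, Finset.mem_union_left _ hz, hxz⟩
    · obtain ⟨z, hz, hxz⟩ := h' α hα (hα'.trans_le (min_le_right _ _)) θ x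
        (hx.trans_le (min_le_right _ _))
      exact ⟨z, Finset.mem_union_right _ hz, hxz⟩

theorem sq_le_of_mem_Icc_rpow (hα : 0 < α) {x : ℝ}
    (hx : x ∈ Icc (-(2 * α ^ (0.6 : ℝ))) (2 * α ^ (0.6 : ℝ))) :
    x ^ 2 ≤ α * (4 * α ^ (0.2 : ℝ)) := by
  have h1 : α ^ (0.6 : ℝ) * α ^ (0.6 : ℝ) = α * α ^ (0.2 : ℝ) := by
    rw [← Real.rpow_add hα, ← Real.rpow_one_add' hα.le (by norm_num)]
    norm_num
  nlinarith [hx.1, hx.2]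

theorem fn_succ_mem_IEnd (hα : 0 < α) (hφb : ∀ θ, |φ θ| ≤ 1) {x : ℝ} (hx : x ^ 2 ≤ α) (n : ℕ)
    (θ : ℝ) : fn a d φ α (n + 1) θ x ∈ Icc (IEnd a α n).1 (IEnd a α n).2 := by
  have hφ : ∀ θ, |α * φ θ| ≤ α := fun θ => by
    rw [abs_mul, abs_of_pos hα]
    exact mul_le_of_le_one_right hα.le (hφb θ)
  induction n with
  | zero =>
    have h := abs_le.1 (hφ θ)
    constructor <;> simp [IEnd, fn, Viana, qm] <;> nlinarith [sq_nonneg x]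
  | succ n ih =>
    rw [fn_succ']
    exact qm_add_mem_IEnd_succ ih (hφ _)

end FibreMaps

theorem le_abs_iterate {a ξ : ℝ}
    (hcrit : ∀ i : ℕ, 1 ≤ i → (qm a)^[i] 0 ∉ Ioo (-(2 * ξ)) (2 * ξ)) (i : ℕ) :
    2 * ξ ≤ |(qm a)^[i + 1] 0| := by
  by_contra! h
  exact hcrit (i + 1) (by omega) (abs_lt.1 h)

theorem le_abs_neg_two_mul_iterate {a ξ : ℝ}
    (hcrit : ∀ i : ℕ, 1 ≤ i → (qm a)^[i] 0 ∉ Ioo (-(2 * ξ)) (2 * ξ)) (i : ℕ) :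
    4 * ξ ≤ |-2 * (qm a)^[i + 1] 0| := by
  rw [abs_mul, abs_neg, abs_two]
  linarith [le_abs_iterate hcrit i]

theorem le_abs_fn_of_contracting {a : ℝ} {d : ℕ} {φ : ℝ → ℝ} (hφb : ∀ θ, |φ θ| ≤ 1)
    {ξ r c C : ℝ} (hξ : 0 < ξ)
    (hcrit : ∀ i : ℕ, 1 ≤ i → (qm a)^[i] 0 ∉ Ioo (-(2 * ξ)) (2 * ξ))
    (hr0 : 0 < r) (hr : r < 1) (hc : 0 < c) (hC : 0 < C)
    (hD : ∀ n, c * r ^ n ≤ |critDeriv a n| ∧ |critDeriv a n| ≤ C * r ^ n) :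
    ∃ α₀ > 0, ∀ α, 0 < α → α < α₀ → ∀ x : ℝ, x ^ 2 ≤ α → ∀ n θ,
      ξ ≤ |fn a d φ α (n + 1) θ x| := by
  obtain ⟨α₀, hα₀, h⟩ := exists_forall_le_of_contracting_recursion hξ hr0 hr hc hC hD
  refine ⟨α₀, hα₀, fun α hα hα' x hx n θ => ?_⟩
  have hφ : ∀ θ, |α * φ θ| ≤ α := fun θ => by
    rw [abs_mul, abs_of_pos hα]
    exact mul_le_of_le_one_right hα.le (hφb θ)
  have hu := h α hα hα' (fun n => |fn a d φ α (n + 1) θ x - (qm a)^[n + 1] 0|)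
    (fun n => abs_nonneg _) ?_ ?_ n
  · have h1 := abs_sub_abs_le_abs_sub ((qm a)^[n + 1] 0) (fn a d φ α (n + 1) θ x)
    rw [abs_sub_comm] at h1
    have h2 := le_abs_iterate hcrit n
    linarith
  · have e : fn a d φ α (0 + 1) θ x - (qm a)^[0 + 1] 0 = -x ^ 2 + α * φ θ := by
      simp [fn, Viana, qm]
      ring
    rw [e]
    refine (abs_add_le _ _).trans ?_
    rw [abs_neg, abs_of_nonneg (sq_nonneg x)]
    linarith [hφ θ]
  · intro n
    set y := fn a d φ α (n + 1) θ x with hy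
    set b := (qm a)^[n + 1] 0 with hb
    have e : fn a d φ α (n + 1 + 1) θ x - (qm a)^[n + 1 + 1] 0 =
        (-2 * b + -(y - b)) * (y - b) + α * φ ((d : ℝ) ^ (n + 1) * θ) := by
      rw [fn_succ', Function.iterate_succ_apply', ← hy, ← hb]
      simp only [qm]
      ring
    rw [e]
    refine (abs_add_le _ _).trans (add_le_add ?_ (hφ _))
    rw [abs_mul]
    refine mul_le_mul_of_nonneg_right ((abs_add_le _ _).trans ?_) (abs_nonneg _)
    rw [abs_neg]

/-- At the time of loss of control, the position in the fibre determines the linearised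
displacement `∑ φ(dʲθ) / Dfʲ(f(0))` up to a small error. -/
theorem abs_weightedSum_sub_le {a : ℝ} {d : ℕ} {φ : ℝ → ℝ} (hφb : ∀ θ, |φ θ| ≤ 1)
    {ξ r c K α ν : ℝ} (hξ : 0 < ξ) (hr : 1 < r) (hc : 0 < c) (hK : 0 < K) (hα : 0 < α)
    (hcrit : ∀ i : ℕ, 1 ≤ i → (qm a)^[i] 0 ∉ Ioo (-(2 * ξ)) (2 * ξ))
    (hD : ∀ n, c * r ^ n ≤ |critDeriv a n|) (hw : Summable fun j => |(critDeriv a j)⁻¹|)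
    (hKL : ∀ n ≤ Nal a ξ α, ∑ i ∈ Finset.range (n + 1), len a α i ≤ K * α * r ^ n)
    (hν : ν ≤ 1) {θ θ' x x' : ℝ} (hx : x ^ 2 ≤ α * ν) (hx' : x' ^ 2 ≤ α * ν) :
    |∑' j, (critDeriv a j)⁻¹ * φ ((d : ℝ) ^ j * θ) -
        ∑' j, (critDeriv a j)⁻¹ * φ ((d : ℝ) ^ j * θ')| ≤
      3 * K / (c * ξ) * |fn a d φ α (Nal a ξ α + 1) θ x - fn a d φ α (Nal a ξ α + 1) θ' x'| + ν +
        2 * (3 / c * √(K / ξ)) * (1 - (√r)⁻¹)⁻¹ * √α := by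
  obtain ⟨-, hsum, hmax⟩ := Nal_spec (a := a) hξ.le hα
  have hν' : α * ν ≤ α := mul_le_of_le_one_right hα.le hν
  have hI := fun n => fn_succ_mem_IEnd (a := a) (d := d) hα hφb (hx.trans hν') n θ
  have hI' := fun n => fn_succ_mem_IEnd (a := a) (d := d) hα hφb (hx'.trans hν') n θ'
  have h := abs_tsum_le_of_affine_recursion (g := fun i => -2 * (qm a)^[i + 1] 0)
    (L := len a α) (N := Nal a ξ α)
    (s := fun i => -(fn a d φ α (i + 1) θ x + fn a d φ α (i + 1) θ' x'))
    (δ := fun i => fn a d φ α (i + 1) θ x - fn a d φ α (i + 1) θ' x')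
    (e := fun j => φ ((d : ℝ) ^ j * θ) - φ ((d : ℝ) ^ j * θ')) (η := x' ^ 2 - x ^ 2)
    hξ hr hc hK hα hD (le_abs_neg_two_mul_iterate hcrit) (len_nonneg hα.le) hsum
    (fun n hn => le_trans ?_ (hKL n hn)) (hmax.trans (hKL _ le_rfl)) ?_ ?_ ?_ ?_
  · rw [← (summable_weightedSum hφb hw _).tsum_sub (summable_weightedSum hφb hw _)]
    have e : ∀ j, (critDeriv a j)⁻¹ * φ ((d : ℝ) ^ j * θ) -
        (critDeriv a j)⁻¹ * φ ((d : ℝ) ^ j * θ') = (φ ((d : ℝ) ^ j * θ) - φ ((d : ℝ) ^ j * θ')) *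
          (∏ i ∈ Finset.range j, (-2 * (qm a)^[i + 1] 0))⁻¹ := fun j => by
      rw [critDeriv]
      ring
    rw [tsum_congr e]
    refine h.trans ?_
    gcongr
    rw [div_le_iff₀ hα, abs_le]
    constructor <;> nlinarith [sq_nonneg x, sq_nonneg x']
  · rw [Finset.sum_range_succ]
    linarith [len_nonneg (a := a) hα.le n]
  · intro i _
    have h1 := abs_sub_le_len (hI i) (iterate_mem_IEnd hα.le i)
    have h2 := abs_sub_le_len (hI' i) (iterate_mem_IEnd hα.le i)
    rw [abs_le] at *
    constructor <;> linarith
  · simp [fn, Viana, qm]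
    ring
  · intro n _
    rw [fn_succ' (n + 1), fn_succ' (n + 1)]
    simp only [qm]
    ring
  · intro j
    have h1 := abs_le.1 (hφb ((d : ℝ) ^ j * θ))
    have h2 := abs_le.1 (hφb ((d : ℝ) ^ j * θ'))
    rw [abs_le]
    constructor <;> linarith

/-- For each `M ∈ ℕ` there is `σ > 0` such that for `α > 0` small enough:
for every admissible curve `X₀ : [0,1) → B_α`, setting
`Θ_n = {θ : |f_n(θ, X₀(θ))| < σ}`, one has `|⋃_{n=1}^{N(α)+M} Θ_n| ≤ 2/3`. -/
theorem recurrence_to_critical_circle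
    (a : ℝ) (ha : a ∈ Set.Ioo (1 : ℝ) 2) (hpre : StrictlyPreperiodic a)
    (d : ℕ) (hd : 2 ≤ d)
    (φ : ℝ → ℝ) (hφa : ∀ x : ℝ, AnalyticAt ℝ φ x) (hφp : Function.Periodic φ 1)
    (hφnc : ∃ s t : ℝ, φ s ≠ φ t) (hφb : ∀ θ : ℝ, |φ θ| ≤ 1)
    (β : ℝ) (hβ1 : 1 < β) (hβ2 : β < |(-1 - Real.sqrt (1 + 4 * a)) / 2|)
    (hβmap : ∀ x ∈ Set.Icc (-β) β, qm a x ∈ Set.Ioo (-β) β)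
    (hβder : ∀ x : ℝ, β ≤ |x| → 2 * β ≤ |deriv (qm a) x|)
    (n₀ : ℕ)
    (hdom : ∃ C₁ R₁ : ℝ, 0 < C₁ ∧ R₁ ∈ Set.Ioo (0 : ℝ) 2 ∧ ∃ α₁ > 0, ∀ α : ℝ, 0 < α → α < α₁ →
      ∀ θ x : ℝ, x ∈ Set.Icc (-β) β → ∀ k : ℕ,
        |deriv (fun y => fn a d φ α k θ y) x| ≤ C₁ * R₁ ^ k ∧
        (n₀ ≤ k → |deriv (fun y => fn a d φ α k θ y) x| ≤ R₁ ^ k ∧ R₁ ^ k ≤ (d : ℝ) ^ k / 6))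
    (ξ₀ : ℝ) (hξ₀ : 0 < ξ₀)
    (hcrit : ∀ i : ℕ, 1 ≤ i → (qm a)^[i] 0 ∉ Set.Ioo (-(2 * ξ₀)) (2 * ξ₀))
    :
    ∀ M : ℕ, ∃ σ > 0, ∃ α₀ > 0, ∀ α : ℝ, 0 < α → α < α₀ → α ≤ ξ₀ →
      ∀ X : ℝ → ℝ, Admissible a d φ α β n₀ X →
        Set.MapsTo X (Set.Ico (0 : ℝ) 1)
          (Set.Icc (-(2 * α ^ (0.6 : ℝ))) (2 * α ^ (0.6 : ℝ))) →
        volume (⋃ n ∈ Set.Icc 1 (Nal a ξ₀ α + M),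
            {θ : ℝ | θ ∈ Set.Ico (0 : ℝ) 1 ∧ |fn a d φ α n θ (X θ)| < σ}) ≤
          (2 / 3 : ℝ≥0∞) := by
  intro M
  obtain ⟨r, c, C, hr0, hr1, hc, hC, hD⟩ := exists_critDeriv_bounds hpre
  have hsmall : ∀ ε > 0, ∀ᶠ α : ℝ in nhds 0, 4 * α ^ (0.2 : ℝ) < ε := by
    intro ε hε
    have hcont : Continuous fun α : ℝ => 4 * α ^ (0.2 : ℝ) :=
      continuous_const.mul (Real.continuous_rpow_const (by norm_num))
    refine (hcont.tendsto 0).eventually_lt_const ?_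
    rw [Real.zero_rpow (by norm_num)]
    simpa using hε
  rcases lt_or_gt_of_ne hr1 with hr | hr
  · obtain ⟨α₀, hα₀, h⟩ := le_abs_fn_of_contracting (d := d) hφb hξ₀ hcrit hr0 hr hc hC hD
    obtain ⟨α₁, hα₁, h1⟩ := Metric.eventually_nhds_iff.1 (hsmall 1 one_pos)
    refine ⟨ξ₀, hξ₀, min α₀ α₁, lt_min hα₀ hα₁, fun α hα hα' _ X _ hX => ?_⟩
    have hν : 4 * α ^ (0.2 : ℝ) < 1 :=
      h1 (by rw [dist_zero_right, Real.norm_of_nonneg hα.le]; exact hα'.trans_le (min_le_right _ _))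
    refine le_trans (le_of_eq ?_) (bot_le : (0 : ℝ≥0∞) ≤ 2 / 3)
    refine measure_mono_null (t := ∅) (iUnion₂_subset fun n hn => ?_) measure_empty
    rintro θ ⟨hθ, hlt⟩
    obtain ⟨k, rfl⟩ := Nat.exists_eq_add_of_le' hn.1
    have hx := sq_le_of_mem_Icc_rpow hα (hX hθ)
    exact absurd hlt (h α hα (hα'.trans_le (min_le_left _ _)) _
      (hx.trans (mul_le_of_le_one_right hα.le hν.le)) k θ).not_gt
  obtain ⟨K, hK, hKL⟩ := exists_sum_len_le hξ₀ hr hc hC hD (le_abs_neg_two_mul_iterate hcrit)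
  have hw : Summable fun j => |(critDeriv a j)⁻¹| := by
    have hgeo := (summable_geometric_of_lt_one (inv_nonneg.2 hr0.le)
      (inv_lt_one_of_one_lt₀ hr)).mul_left c⁻¹
    refine hgeo.of_nonneg_of_le (fun j => abs_nonneg _) fun j => ?_
    rw [abs_inv, inv_pow, ← mul_inv]
    exact inv_anti₀ (by positivity) (hD j).1
  have hw0 : (critDeriv a 0)⁻¹ ≠ 0 := by simp [critDeriv]
  obtain ⟨E, hE⟩ := exists_finset_near_of_abs_fn_lt_of_lt a d hφb M
  obtain ⟨ε, hε, hvol⟩ :=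
    exists_volume_weightedSum_near_le hφa hφp hφnc hφb hd hw hw0 {z // z ∈ E}
  set B : ℝ := 2 * (3 / c * √(K / ξ₀)) * (1 - (√r)⁻¹)⁻¹ with hB
  set δ : ℝ := ε / 3 / (3 * K / (c * ξ₀)) / 2 with hδ
  have hδ0 : 0 < δ := by positivity
  obtain ⟨σ, hσ, α₁, hα₁, hnear⟩ := hE δ hδ0
  have hsqrt : ∀ᶠ α : ℝ in nhds 0, B * √α < ε / 3 := by
    have hcont : Continuous fun α : ℝ => B * √α := by fun_prop
    refine (hcont.tendsto 0).eventually_lt_const ?_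
    simpa using hε
  obtain ⟨α₂, hα₂, hev⟩ := Metric.eventually_nhds_iff.1
    ((hsmall (min 1 (ε / 3)) (lt_min one_pos (by positivity))).and hsqrt)
  refine ⟨min σ ξ₀, lt_min hσ hξ₀, min α₁ α₂, lt_min hα₁ hα₂, fun α hα hα' _ X _ hX => ?_⟩
  obtain ⟨hν, hBα⟩ := hev (y := α)
    (by rw [dist_zero_right, Real.norm_of_nonneg hα.le]; exact hα'.trans_le (min_le_right _ _))
  set ν : ℝ := 4 * α ^ (0.2 : ℝ) with hνdef
  have hν1 : ν ≤ 1 := hν.le.trans (min_le_left _ _)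
  have hνε : ν ≤ ε / 3 := hν.le.trans (min_le_right _ _)
  have hx : ∀ θ ∈ Ico (0 : ℝ) 1, X θ ^ 2 ≤ α * ν := fun θ hθ => sq_le_of_mem_Icc_rpow hα (hX hθ)
  obtain ⟨hlt, hsum, -⟩ := Nal_spec (a := a) hξ₀.le hα
  set N := Nal a ξ₀ α with hN
  have hcompare : ∀ θ ∈ Ico (0 : ℝ) 1, ∀ θ' ∈ Ico (0 : ℝ) 1,
      |fn a d φ α (N + 1) θ (X θ) - fn a d φ α (N + 1) θ' (X θ')| ≤ 2 * δ →
      |∑' j, (critDeriv a j)⁻¹ * φ ((d : ℝ) ^ j * θ) -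
        ∑' j, (critDeriv a j)⁻¹ * φ ((d : ℝ) ^ j * θ')| ≤ ε := by
    intro θ hθ θ' hθ' hclose
    have h := abs_weightedSum_sub_le hφb hξ₀ hr hc hK hα hcrit (fun n => (hD n).1) hw
      (hKL α hα N hsum) hν1 (hx θ hθ) (hx θ' hθ') (θ := θ) (θ' := θ') (d := d)
    have h2 : 3 * K / (c * ξ₀) *
        |fn a d φ α (N + 1) θ (X θ) - fn a d φ α (N + 1) θ' (X θ')| ≤ ε / 3 := by
      calc _ ≤ 3 * K / (c * ξ₀) * (2 * δ) := by gcongr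
        _ = ε / 3 := by
          rw [hδ]
          field_simp
    linarith
  have hcenter : ∀ z : {z // z ∈ E}, ∃ t ∈ Icc (0 : ℝ) 1, ∀ θ ∈ Ico (0 : ℝ) 1,
      |fn a d φ α (N + 1) θ (X θ) - z| < δ →
      |∑' j, (critDeriv a j)⁻¹ * φ ((d : ℝ) ^ j * θ) -
        ∑' j, (critDeriv a j)⁻¹ * φ ((d : ℝ) ^ j * t)| ≤ ε := by
    intro z
    by_cases hz : ∃ t ∈ Ico (0 : ℝ) 1, |fn a d φ α (N + 1) t (X t) - z| < δ
    · obtain ⟨t, ht, htz⟩ := hz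
      refine ⟨t, Ico_subset_Icc_self ht, fun θ hθ hθz => hcompare θ hθ t ht ?_⟩
      rw [abs_sub_comm] at htz
      linarith [abs_sub_le (fn a d φ α (N + 1) θ (X θ)) z (fn a d φ α (N + 1) t (X t))]
    · exact ⟨0, by simp, fun θ hθ hθz => absurd ⟨θ, hθ, hθz⟩ hz⟩
  choose t ht htE using hcenter
  refine (measure_mono (iUnion₂_subset fun n hn => ?_)).trans (hvol t ht)
  rintro θ ⟨hθ, hlow⟩
  refine ⟨?_, hθ⟩
  rcases le_or_gt n N with hnN | hnN
  · obtain ⟨k, rfl⟩ := Nat.exists_eq_add_of_le' hn.1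
    have h1 := abs_sub_le_len (fn_succ_mem_IEnd (a := a) (d := d) hα hφb
      ((hx θ hθ).trans (mul_le_of_le_one_right hα.le hν1)) k θ) (iterate_mem_IEnd hα.le k)
    have h2 := abs_sub_abs_le_abs_sub ((qm a)^[k + 1] 0) (fn a d φ α (k + 1) θ (X θ))
    rw [abs_sub_comm] at h2
    have h3 := le_abs_iterate hcrit k
    have h4 := hlt k (by omega)
    have h5 := hlow.trans_le (min_le_right _ _)
    linarith
  · obtain ⟨k, rfl⟩ := Nat.exists_eq_add_of_le' (Nat.succ_le_of_lt hnN)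
    have hk : k < M := by have := hn.2; omega
    rw [Nat.succ_eq_add_one, fn_add] at hlow
    obtain ⟨z, hz, hzδ⟩ := hnear α hα (hα'.trans_le (min_le_left _ _)) k hk _ _
      (hlow.trans_le (min_le_left _ _))
    exact ⟨⟨z, hz⟩, htE ⟨z, hz⟩ θ hθ hzδ⟩
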